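/- Let α, β > 0 and 0 < p ≤ ∞, and let n(ε,d) = min{n ∈ ℕ : a_n(Id: G^{α,β,p}(T^d) → L2(T^d)) ≤ ε} be the information complexity of the approximation problem Id: G^{α,β,p}(T^d) → L2(T^d). Then the problem is quasi-polynomially tractable if and only if α ≥ p. -/

import Mathlib

open MeasureTheory Real Filter
open scoped ENNReal NNReal BigOperators

noncomputable section

/-- The `d`-torus `T^d`, modeled as the cube `[0,2π]^d` with Lebesgue measure. -/
def torusMeasure (d : ℕ) : Measure (Fin d → ℝ) :=
  volume.restrict (Set.univ.pi fun _ => Set.Icc 0 (2 * π))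

/-- `L2(T^d)`. -/
abbrev TorusL2 (d : ℕ) := Lp ℂ 2 (torusMeasure d)

/-- The Fourier coefficient `c_k(f) = (2π)^{-d/2} ∫ f(x) e^{-i k·x} dx`. -/
def fourierCoeffT {d : ℕ} (f : TorusL2 d) (k : Fin d → ℤ) : ℂ :=
  (((2 * π) ^ (-(d : ℝ) / 2) : ℝ) : ℂ) *
    ∫ x, f x * Complex.exp (-Complex.I * ((∑ j, (k j : ℝ) * x j : ℝ) : ℂ)) ∂(torusMeasure d)

/-- The squared `H^w(T^d)` norm `∑_k w(k)^2 |c_k(f)|^2`, valued in `ℝ≥0∞`. -/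
def wNormSq {d : ℕ} (w : (Fin d → ℤ) → ℝ) (f : TorusL2 d) : ℝ≥0∞ :=
  ∑' k : Fin d → ℤ, ENNReal.ofReal (w k ^ 2 * ‖fourierCoeffT f k‖ ^ 2)

/-- The `n`-th approximation number `a_n(Id : H^{w₁}(T^d) → H^{w₂}(T^d))`: the infimum of all
worst-case error bounds `r ≥ 0` achievable by a linear map `A` of rank `< n`, where the error
`‖f - A f‖` is measured in the `H^{w₂}` norm on the unit ball of `H^{w₁}`.
(With `w₂ ≡ 1` this is the approximation error in `L2(T^d)`, by Parseval.) -/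
def approxNumber (d : ℕ) (w₁ w₂ : (Fin d → ℤ) → ℝ) (n : ℕ) : ℝ :=
  sInf { r : ℝ | 0 ≤ r ∧
    ∃ A : TorusL2 d →ₗ[ℂ] TorusL2 d,
      Module.Finite ℂ (LinearMap.range A) ∧
      Module.finrank ℂ (LinearMap.range A) < n ∧
      ∀ f : TorusL2 d, wNormSq w₁ f ≤ 1 →
        wNormSq w₂ (f - A f) ≤ ENNReal.ofReal r ^ 2 }

/-- constant weight `1`, defining `L2(T^d)` as a weighted space. -/
def constOne (d : ℕ) : (Fin d → ℤ) → ℝ := fun _ => 1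

/-- The `ℓ_p` (quasi-)norm on `ℝ^d`, for `0 < p ≤ ∞`. -/
def pNorm (d : ℕ) (p : ℝ≥0∞) (x : Fin d → ℝ) : ℝ :=
  if p = ∞ then ⨆ j, |x j| else (∑ j, |x j| ^ p.toReal) ^ (1 / p.toReal)

/-- The isotropic Sobolev weight `w_{s,p}`. -/
def wIso (d : ℕ) (s : ℝ) (p : ℝ≥0∞) (k : Fin d → ℤ) : ℝ :=
  if p = ∞ then (max 1 (⨆ j, |(k j : ℝ)|)) ^ s
  else (1 + ∑ j, |(k j : ℝ)| ^ p.toReal) ^ (s / p.toReal)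

/-- The Gevrey weight `w^G_{α,β,p}(k) = exp(β ‖k‖_p^α)`. -/
def wGevrey (d : ℕ) (α β : ℝ) (p : ℝ≥0∞) (k : Fin d → ℤ) : ℝ :=
  Real.exp (β * pNorm d p (fun j => (k j : ℝ)) ^ α)

/-- The covering number `N_ε(A)`: the minimal number of closed `ℓ_∞`-balls of radius `ε`
needed to cover `A` (note that on `Fin d → ℝ` the canonical metric is the sup-metric). -/
def coveringNumber {d : ℕ} (ε : ℝ) (A : Set (Fin d → ℝ)) : ℕ∞ :=
  ⨅ (S : Finset (Fin d → ℝ)) (_ : A ⊆ ⋃ x ∈ S, Metric.closedBall x ε), (S.card : ℕ∞)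

/-- The (non-dyadic) entropy number `ε_n(A, ℓ_∞^d)`. -/
def entropyNumber {d : ℕ} (n : ℕ) (A : Set (Fin d → ℝ)) : ℝ :=
  sInf { ε : ℝ | 0 < ε ∧ coveringNumber ε A ≤ (n : ℕ∞) }

/-- The grid number `G(A) = #(A ∩ ℤ^d)`. -/
def gridNumber {d : ℕ} (A : Set (Fin d → ℝ)) : ℕ∞ :=
  (A ∩ {x | ∀ i, ∃ m : ℤ, x i = (m : ℝ)}).encard

/-- The closed unit ball `B_p^d` of `ℓ_p^d`. -/
def unitBallP (d : ℕ) (p : ℝ≥0∞) : Set (Fin d → ℝ) := {x | pNorm d p x ≤ 1}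

end

noncomputable section

/-- The information complexity `n(ε,d)` of the approximation problem
`Id : H^{w₁}(T^d) → H^{w₂}(T^d)`. -/
def infoComplexity (d : ℕ) (w₁ w₂ : (Fin d → ℤ) → ℝ) (ε : ℝ) : ℕ :=
  sInf {n : ℕ | 0 < n ∧ approxNumber d w₁ w₂ n ≤ ε}

/-- Quasi-polynomial tractability: `n(ε,d) ≤ C exp(t(1+ln(1/ε))(1+ln d))`. -/
def quasiPolyTractableGevrey (α β : ℝ) (p : ℝ≥0∞) : Prop :=
  ∃ C t : ℝ, 0 < C ∧ 0 < t ∧ ∀ (ε : ℝ) (d : ℕ), 0 < ε → ε < 1 → 0 < d →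
    (infoComplexity d (wGevrey d α β p) (constOne d) ε : ℝ)
      ≤ C * Real.exp (t * (1 + Real.log (1 / ε)) * (1 + Real.log d))

instance isFiniteMeasure_torusMeasure (d : ℕ) : IsFiniteMeasure (torusMeasure d) :=
  isFiniteMeasure_restrict.2 (isCompact_univ_pi fun _ => isCompact_Icc).measure_lt_top.ne

theorem torusMeasure_eq_pi (d : ℕ) :
    torusMeasure d = Measure.pi fun _ : Fin d => volume.restrict (Set.Icc 0 (2 * π)) := by
  rw [torusMeasure, volume_pi, Measure.restrict_pi_pi]

/-- The character `x ↦ e^{i k·x}`. -/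
def torusChar {d : ℕ} (k : Fin d → ℤ) (x : Fin d → ℝ) : ℂ :=
  Complex.exp (((∑ j, (k j : ℝ) * x j : ℝ) : ℂ) * Complex.I)

theorem continuous_torusChar {d : ℕ} (k : Fin d → ℤ) : Continuous (torusChar k) := by
  unfold torusChar
  fun_prop

theorem norm_torusChar {d : ℕ} (k : Fin d → ℤ) (x : Fin d → ℝ) : ‖torusChar k x‖ = 1 :=
  Complex.norm_exp_ofReal_mul_I _

theorem torusChar_mul {d : ℕ} (k m : Fin d → ℤ) (x : Fin d → ℝ) :
    torusChar k x * torusChar m x = torusChar (k + m) x := by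
  simp only [torusChar, ← Complex.exp_add, ← add_mul, ← Complex.ofReal_add,
    ← Finset.sum_add_distrib, Pi.add_apply, Int.cast_add]

theorem torusChar_eq_prod {d : ℕ} (k : Fin d → ℤ) (x : Fin d → ℝ) :
    torusChar k x = ∏ j, Complex.exp ((k j : ℂ) * Complex.I * x j) := by
  rw [torusChar, ← Complex.exp_sum]
  push_cast
  rw [Finset.sum_mul]
  exact congrArg _ (Finset.sum_congr rfl fun j _ => by ring)

theorem integral_exp_int_mul_I (m : ℤ) :
    ∫ x in Set.Icc 0 (2 * π), Complex.exp ((m : ℂ) * Complex.I * x) =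
      if m = 0 then (2 * π : ℂ) else 0 := by
  rw [integral_Icc_eq_integral_Ioc, ← intervalIntegral.integral_of_le two_pi_pos.le]
  split_ifs with hm
  · simp [hm]
  · have hc : (m : ℂ) * Complex.I ≠ 0 := mul_ne_zero (by exact_mod_cast hm) Complex.I_ne_zero
    rw [integral_exp_mul_complex hc, div_eq_zero_iff]
    left
    have h := Complex.exp_int_mul_two_pi_mul_I m
    push_cast
    rw [show (m : ℂ) * Complex.I * (2 * π) = m * (2 * π * Complex.I) by ring, h]
    simp

theorem integral_torusChar {d : ℕ} (k : Fin d → ℤ) :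
    ∫ x, torusChar k x ∂(torusMeasure d) = if k = 0 then (2 * π : ℂ) ^ d else 0 := by
  simp_rw [torusMeasure_eq_pi, torusChar_eq_prod]
  rw [integral_fintype_prod_eq_prod
    (f := fun j (y : ℝ) => Complex.exp ((k j : ℂ) * Complex.I * y))]
  simp_rw [integral_exp_int_mul_I]
  split_ifs with hk
  · simp [hk]
  · obtain ⟨j, hj⟩ := Function.ne_iff.1 hk
    exact Finset.prod_eq_zero (Finset.mem_univ j) (if_neg hj)

theorem fourierCoeffT_eq {d : ℕ} (f : TorusL2 d) (k : Fin d → ℤ) :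
    fourierCoeffT f k = (((2 * π) ^ (-(d : ℝ) / 2) : ℝ) : ℂ) *
      ∫ x, f x * torusChar (-k) x ∂(torusMeasure d) := by
  have h : ∀ x : Fin d → ℝ,
      Complex.exp (-Complex.I * ((∑ j, (k j : ℝ) * x j : ℝ) : ℂ)) = torusChar (-k) x := by
    intro x
    simp only [torusChar, Pi.neg_apply, Int.cast_neg, neg_mul, Finset.sum_neg_distrib,
      Complex.ofReal_neg, mul_comm Complex.I]
  simp_rw [fourierCoeffT, h]

theorem integrable_mul_torusChar {d : ℕ} (f : TorusL2 d) (k : Fin d → ℤ) :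
    Integrable (fun x => f x * torusChar k x) (torusMeasure d) :=
  ((Lp.memLp f).integrable one_le_two).mul_bdd (c := 1)
    (continuous_torusChar k).aestronglyMeasurable (ae_of_all _ fun x => (norm_torusChar k x).le)

/-- The Fourier coefficient `c_k` as a linear functional. -/
def fourierCoeffLinear {d : ℕ} (k : Fin d → ℤ) : TorusL2 d →ₗ[ℂ] ℂ where
  toFun f := fourierCoeffT f k
  map_add' f g := by
    simp_rw [fourierCoeffT_eq]
    rw [← mul_add, ← integral_add (integrable_mul_torusChar f _) (integrable_mul_torusChar g _)]
    congr 1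
    apply integral_congr_ae
    filter_upwards [Lp.coeFn_add f g] with x hx
    rw [hx, Pi.add_apply, add_mul]
  map_smul' c f := by
    simp_rw [fourierCoeffT_eq, RingHom.id_apply, smul_eq_mul]
    rw [mul_left_comm c, ← integral_const_mul c]
    congr 1
    apply integral_congr_ae
    filter_upwards [Lp.coeFn_smul c f] with x hx
    rw [hx, Pi.smul_apply, smul_eq_mul, mul_assoc]

theorem fourierCoeffLinear_apply {d : ℕ} (k : Fin d → ℤ) (f : TorusL2 d) :
    fourierCoeffLinear k f = fourierCoeffT f k := rfl

theorem memLp_torusChar {d : ℕ} (k : Fin d → ℤ) : MemLp (torusChar k) 2 (torusMeasure d) :=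
  MemLp.of_bound (continuous_torusChar k).aestronglyMeasurable 1
    (ae_of_all _ fun x => (norm_torusChar k x).le)

/-- The `L2`-normalized character `(2π)^{-d/2} e^{i k·x}`. -/
def torusMode {d : ℕ} (k : Fin d → ℤ) : TorusL2 d :=
  (((2 * π) ^ (-(d : ℝ) / 2) : ℝ) : ℂ) • (memLp_torusChar k).toLp

theorem fourierCoeffT_torusMode {d : ℕ} (m k : Fin d → ℤ) :
    fourierCoeffT (torusMode m) k = if m = k then 1 else 0 := by
  rw [← fourierCoeffLinear_apply, torusMode, map_smul, fourierCoeffLinear_apply, fourierCoeffT_eq,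
    integral_congr_ae (g := torusChar (m + -k))]
  · rw [integral_torusChar, smul_eq_mul, ← mul_assoc]
    simp only [add_neg_eq_zero]
    split_ifs with h
    · rw [← Complex.ofReal_mul, ← Real.rpow_add two_pi_pos]
      have : ((2 * π : ℂ)) ^ d = ((((2 * π) ^ (d : ℝ) : ℝ)) : ℂ) := by
        rw [Real.rpow_natCast]; push_cast; rfl
      rw [this, ← Complex.ofReal_mul, ← Real.rpow_add two_pi_pos]
      simp
    · simp
  · filter_upwards [(memLp_torusChar m).coeFn_toLp] with x hx
    rw [hx, torusChar_mul]

/-- The trigonometric polynomial with coefficients `a` on the finite frequency set `S`. -/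
def trigPoly {d : ℕ} (S : Finset (Fin d → ℤ)) : ((Fin d → ℤ) → ℂ) →ₗ[ℂ] TorusL2 d :=
  ∑ k ∈ S, (LinearMap.proj k).smulRight (torusMode k)

theorem trigPoly_apply {d : ℕ} (S : Finset (Fin d → ℤ)) (a : (Fin d → ℤ) → ℂ) :
    trigPoly S a = ∑ k ∈ S, a k • torusMode k := by
  simp [trigPoly, LinearMap.sum_apply]

theorem fourierCoeffT_trigPoly {d : ℕ} (S : Finset (Fin d → ℤ)) (a : (Fin d → ℤ) → ℂ)
    (k : Fin d → ℤ) : fourierCoeffT (trigPoly S a) k = if k ∈ S then a k else 0 := by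
  rw [← fourierCoeffLinear_apply, trigPoly_apply, map_sum]
  simp_rw [map_smul, fourierCoeffLinear_apply, fourierCoeffT_torusMode, smul_eq_mul, mul_ite,
    mul_one, mul_zero]
  rw [Finset.sum_ite_eq']

theorem wNormSq_trigPoly {d : ℕ} (w : (Fin d → ℤ) → ℝ) (S : Finset (Fin d → ℤ))
    (a : (Fin d → ℤ) → ℂ) :
    wNormSq w (trigPoly S a) = ENNReal.ofReal (∑ k ∈ S, w k ^ 2 * ‖a k‖ ^ 2) := by
  rw [wNormSq, tsum_eq_sum (s := S), ENNReal.ofReal_sum_of_nonneg fun k _ => by positivity]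
  · exact Finset.sum_congr rfl fun k hk => by rw [fourierCoeffT_trigPoly, if_pos hk]
  · intro k hk
    simp [fourierCoeffT_trigPoly, hk]

theorem approxNumber_le_of_forall_notMem {d : ℕ} {w : (Fin d → ℤ) → ℝ}
    {S : Finset (Fin d → ℤ)} {ε : ℝ} {n : ℕ} (hε : 0 ≤ ε) (hn : S.card < n)
    (hw : ∀ k ∉ S, 1 ≤ ε * w k) : approxNumber d w (constOne d) n ≤ ε := by
  refine csInf_le ⟨0, fun r hr => hr.1⟩ ⟨hε,
    trigPoly S ∘ₗ LinearMap.pi fourierCoeffLinear, ?_⟩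
  have hrange : LinearMap.range (trigPoly S ∘ₗ LinearMap.pi fourierCoeffLinear) ≤
      Submodule.span ℂ (torusMode '' (S : Set (Fin d → ℤ))) := by
    rintro _ ⟨f, rfl⟩
    rw [LinearMap.comp_apply, trigPoly_apply]
    exact Submodule.sum_mem _ fun k hk =>
      Submodule.smul_mem _ _ (Submodule.subset_span ⟨k, hk, rfl⟩)
  have hfin : (torusMode '' (S : Set (Fin d → ℤ))).Finite := S.finite_toSet.image _
  have : Module.Finite ℂ (Submodule.span ℂ (torusMode '' (S : Set (Fin d → ℤ)))) :=
    FiniteDimensional.span_of_finite ℂ hfin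
  refine ⟨Submodule.finiteDimensional_of_le hrange, ?_, fun f hf => ?_⟩
  · classical
    refine lt_of_le_of_lt ((Submodule.finrank_mono hrange).trans ?_) hn
    rw [← Finset.coe_image]
    exact (finrank_span_finset_le_card _).trans Finset.card_image_le
  · have key : wNormSq (constOne d) (f - (trigPoly S ∘ₗ LinearMap.pi fourierCoeffLinear) f) ≤
        ENNReal.ofReal ε ^ 2 * wNormSq w f := by
      rw [wNormSq, wNormSq, ← ENNReal.tsum_mul_left]
      refine ENNReal.tsum_le_tsum fun k => ?_
      rw [← ENNReal.ofReal_pow hε, ← ENNReal.ofReal_mul (sq_nonneg ε)]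
      apply ENNReal.ofReal_le_ofReal
      rw [← fourierCoeffLinear_apply, map_sub, LinearMap.comp_apply, fourierCoeffLinear_apply,
        fourierCoeffLinear_apply, fourierCoeffT_trigPoly]
      split_ifs with hk
      · simp only [LinearMap.pi_apply, fourierCoeffLinear_apply, sub_self, norm_zero]
        rw [zero_pow two_ne_zero, mul_zero]
        positivity
      · rw [sub_zero, constOne, one_pow, one_mul, ← mul_assoc, ← mul_pow]
        exact le_mul_of_one_le_left (by positivity) (one_le_pow₀ (hw k hk))
    exact key.trans (mul_le_of_le_one_right' hf)

theorem one_div_le_approxNumber {d : ℕ} {w : (Fin d → ℤ) → ℝ} (hw : ∀ k, 1 ≤ w k)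
    {S : Finset (Fin d → ℤ)} {W : ℝ} (hW : 0 < W) (hS : ∀ k ∈ S, w k ≤ W) {n : ℕ} (hn0 : 0 < n)
    (hn : n ≤ S.card) : 1 / W ≤ approxNumber d w (constOne d) n := by
  refine le_csInf ⟨1, zero_le_one, 0, ?_, ?_, fun f hf => ?_⟩ ?_
  · rw [LinearMap.range_zero]; infer_instance
  · rwa [LinearMap.range_zero, finrank_bot]
  · rw [LinearMap.zero_apply, sub_zero, ENNReal.ofReal_one, one_pow]
    refine le_trans (ENNReal.tsum_le_tsum fun k => ENNReal.ofReal_le_ofReal ?_) hf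
    exact mul_le_mul_of_nonneg_right (pow_le_pow_left₀ zero_le_one (hw k) 2) (by positivity)
  rintro r ⟨hr, A, hfin, hrank, hA⟩
  classical
  let E : (S → ℂ) →ₗ[ℂ] ((Fin d → ℤ) → ℂ) := LinearMap.pi fun k =>
    if h : k ∈ S then LinearMap.proj (⟨k, h⟩ : S) else 0
  have hE : ∀ (a : S → ℂ) (k : S), E a k = a k := fun a k => by simp [E]
  have hker := LinearMap.ker_ne_bot_of_finrank_lt (f := A.rangeRestrict ∘ₗ trigPoly S ∘ₗ E)
    (by simpa using hrank.trans_le hn)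
  obtain ⟨a, ha, ha0⟩ := (Submodule.ne_bot_iff _).1 hker
  have hAa : A (trigPoly S (E a)) = 0 := congrArg Subtype.val (LinearMap.mem_ker.1 ha)
  set b := E a with hb
  set N := ∑ k ∈ S, w k ^ 2 * ‖b k‖ ^ 2 with hN
  set M := ∑ k ∈ S, ‖b k‖ ^ 2 with hM
  have hMpos : 0 < M := by
    obtain ⟨k, hk⟩ := Function.ne_iff.1 ha0
    refine Finset.sum_pos' (fun _ _ => by positivity) ⟨k, k.2, ?_⟩
    have : b k ≠ 0 := by rw [hb, hE]; exact hk
    positivity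
  have hMN : M ≤ N := Finset.sum_le_sum fun k _ =>
    le_mul_of_one_le_left (by positivity) (one_le_pow₀ (hw k))
  have hNM : N ≤ W ^ 2 * M := by
    rw [hM, Finset.mul_sum]
    refine Finset.sum_le_sum fun k hk => mul_le_mul_of_nonneg_right ?_ (by positivity)
    exact pow_le_pow_left₀ (zero_le_one.trans (hw k)) (hS k hk) 2
  have hNpos : 0 < N := hMpos.trans_le hMN
  let c : ℂ := ((1 / √N : ℝ) : ℂ)
  have hc : ‖c‖ ^ 2 = 1 / N := by
    rw [Complex.norm_real, Real.norm_eq_abs, sq_abs, div_pow, one_pow, Real.sq_sqrt hNpos.le]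
  have hscale : ∀ v : (Fin d → ℤ) → ℝ,
      ∑ k ∈ S, v k ^ 2 * ‖(c • b) k‖ ^ 2 = 1 / N * ∑ k ∈ S, v k ^ 2 * ‖b k‖ ^ 2 := fun v => by
    rw [Finset.mul_sum]
    refine Finset.sum_congr rfl fun k _ => ?_
    rw [Pi.smul_apply, norm_smul, mul_pow, hc]
    ring
  have h := hA (trigPoly S (c • b)) (by
    rw [wNormSq_trigPoly, hscale, ← hN, one_div_mul_cancel hNpos.ne', ENNReal.ofReal_one])
  rw [map_smul (trigPoly S), map_smul A, hAa, smul_zero, sub_zero, ← map_smul, wNormSq_trigPoly,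
    hscale, ← ENNReal.ofReal_pow hr, ENNReal.ofReal_le_ofReal_iff (by positivity)] at h
  simp only [constOne, one_pow, one_mul] at h
  rw [← hM] at h
  refine le_of_sq_le_sq ?_ hr
  refine le_trans ?_ h
  rw [div_pow, one_pow, one_div_mul_eq_div, div_le_div_iff₀ (by positivity) hNpos]
  linarith

theorem infoComplexity_le {d : ℕ} {w : (Fin d → ℤ) → ℝ} {S : Finset (Fin d → ℤ)} {ε : ℝ}
    (hε : 0 ≤ ε) (hw : ∀ k ∉ S, 1 ≤ ε * w k) :
    infoComplexity d w (constOne d) ε ≤ S.card + 1 :=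
  Nat.sInf_le ⟨Nat.succ_pos _, approxNumber_le_of_forall_notMem hε (Nat.lt_succ_self _) hw⟩

theorem card_lt_infoComplexity {d : ℕ} {w : (Fin d → ℤ) → ℝ} (hw : ∀ k, 1 ≤ w k)
    {S T : Finset (Fin d → ℤ)} {ε : ℝ} (hε : 0 < ε) (hT : ∀ k ∉ T, 1 ≤ ε * w k)
    {W : ℝ} (hεW : ε * W < 1) (hW : 0 < W) (hS : ∀ k ∈ S, w k ≤ W) :
    S.card < infoComplexity d w (constOne d) ε := by
  have hmem : infoComplexity d w (constOne d) ε ∈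
      {n : ℕ | 0 < n ∧ approxNumber d w (constOne d) n ≤ ε} :=
    Nat.sInf_mem ⟨T.card + 1, Nat.succ_pos _,
      approxNumber_le_of_forall_notMem hε.le (Nat.lt_succ_self _) hT⟩
  by_contra! hle
  have h := (one_div_le_approxNumber hw hW hS hmem.1 hle).trans hmem.2
  rw [div_le_iff₀ hW] at h
  linarith

theorem pNorm_nonneg (d : ℕ) (p : ℝ≥0∞) (x : Fin d → ℝ) : 0 ≤ pNorm d p x := by
  unfold pNorm
  split_ifs
  · exact Real.iSup_nonneg fun j => abs_nonneg _
  · positivity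

theorem abs_le_pNorm {d : ℕ} {p : ℝ≥0∞} (hp : 0 < p) (x : Fin d → ℝ) (j : Fin d) :
    |x j| ≤ pNorm d p x := by
  unfold pNorm
  split_ifs with h
  · exact le_ciSup (f := fun j => |x j|) (Set.finite_range _).bddAbove j
  · have hq : 0 < p.toReal := ENNReal.toReal_pos hp.ne' h
    calc |x j| = (|x j| ^ p.toReal) ^ (1 / p.toReal) := by
          rw [one_div, Real.rpow_rpow_inv (abs_nonneg _) hq.ne']
      _ ≤ _ := Real.rpow_le_rpow (by positivity)
          (Finset.single_le_sum (f := fun j => |x j| ^ p.toReal) (fun i _ => by positivity)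
            (Finset.mem_univ j)) (by positivity)

theorem one_le_abs_intCast {m : ℤ} (hm : m ≠ 0) : 1 ≤ |(m : ℝ)| := by
  exact_mod_cast Int.one_le_abs hm

/-- For integer vectors and `α ≥ p`, the power `‖k‖_p^α` dominates `‖k‖_p^p`. -/
theorem sum_abs_rpow_le_pNorm_rpow {d : ℕ} {p : ℝ≥0∞} (hp : 0 < p) (hp' : p ≠ ∞) {α : ℝ}
    (hα : p.toReal ≤ α) (k : Fin d → ℤ) :
    ∑ j, |(k j : ℝ)| ^ p.toReal ≤ pNorm d p (fun j => (k j : ℝ)) ^ α := by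
  have hq : 0 < p.toReal := ENNReal.toReal_pos hp.ne' hp'
  by_cases hk : k = 0
  · simp [hk, Real.zero_rpow hq.ne', Real.rpow_nonneg (pNorm_nonneg _ _ _)]
  obtain ⟨j, hj⟩ := Function.ne_iff.1 hk
  have hs : 1 ≤ ∑ j, |(k j : ℝ)| ^ p.toReal :=
    (Real.one_le_rpow (one_le_abs_intCast hj) hq.le).trans
      (Finset.single_le_sum (f := fun j => |(k j : ℝ)| ^ p.toReal) (fun i _ => by positivity)
        (Finset.mem_univ j))
  rw [pNorm, if_neg hp', ← Real.rpow_mul (by positivity), one_div_mul_eq_div]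
  conv_lhs => rw [← Real.rpow_one (∑ j, _)]
  exact Real.rpow_le_rpow_of_exponent_le hs ((one_le_div hq).2 hα)

theorem one_le_wGevrey {d : ℕ} {α β : ℝ} (hβ : 0 < β) (p : ℝ≥0∞) (k : Fin d → ℤ) :
    1 ≤ wGevrey d α β p k :=
  Real.one_le_exp (mul_nonneg hβ.le (Real.rpow_nonneg (pNorm_nonneg _ _ _) _))

theorem mul_wGevrey_lt_one_iff {d : ℕ} {α β ε : ℝ} (hβ : 0 < β) (hε : 0 < ε) (p : ℝ≥0∞)
    (k : Fin d → ℤ) : ε * wGevrey d α β p k < 1 ↔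
      pNorm d p (fun j => (k j : ℝ)) ^ α < Real.log (1 / ε) / β := by
  rw [wGevrey, ← lt_div_iff₀' hε, ← Real.lt_log_iff_exp_lt (by positivity), lt_div_iff₀' hβ]

theorem finite_setOf_abs_intCast_rpow_lt {α : ℝ} (hα : 0 < α) (R : ℝ) :
    {m : ℤ | |(m : ℝ)| ^ α < R}.Finite := by
  refine (Set.finite_Icc (-⌈R ^ (1 / α)⌉) ⌈R ^ (1 / α)⌉).subset fun m (hm : _ < R) => ?_
  have h : |(m : ℝ)| ≤ R ^ (1 / α) := by
    rw [← Real.rpow_rpow_inv (abs_nonneg (m : ℝ)) hα.ne', one_div]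
    exact Real.rpow_le_rpow (by positivity) hm.le (by positivity)
  rw [Set.mem_Icc, ← abs_le]
  exact_mod_cast h.trans (Int.le_ceil _)

theorem finite_setOf_mul_wGevrey_lt_one (d : ℕ) {α β ε : ℝ} (hα : 0 < α) (hβ : 0 < β)
    (hε : 0 < ε) {p : ℝ≥0∞} (hp : 0 < p) : {k | ε * wGevrey d α β p k < 1}.Finite := by
  refine (Set.Finite.pi' fun _ : Fin d =>
    finite_setOf_abs_intCast_rpow_lt hα (Real.log (1 / ε) / β)).subset fun k hk j => ?_
  exact (Real.rpow_le_rpow (abs_nonneg _) (abs_le_pNorm hp (fun j => (k j : ℝ)) j) hα.le).trans_lt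
    ((mul_wGevrey_lt_one_iff hβ hε p k).1 hk)

theorem summable_exp_neg_abs_rpow {q : ℝ} (hq : 0 < q) :
    Summable fun m : ℤ => Real.exp (-|(m : ℝ)| ^ q) := by
  have h : Summable fun n : ℕ => Real.exp (-(n : ℝ) ^ q) := by
    have ho := (isLittleO_exp_neg_mul_rpow_atTop one_pos (-2 / q)).comp_tendsto
      ((tendsto_rpow_atTop hq).comp tendsto_natCast_atTop_atTop)
    refine summable_of_isBigO_nat (Real.summable_nat_rpow.2 (by norm_num : (-2 : ℝ) < -1)) ?_
    convert! ho.isBigO using 2 with n n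
    · simp
    · simp only [Function.comp_apply]
      rw [← Real.rpow_mul n.cast_nonneg, mul_div_cancel₀ _ hq.ne']
  exact Summable.of_nat_of_neg (by simpa using h) (by simpa using h)

theorem sum_exp_neg_mul_abs_rpow_le {q : ℝ} (hq : 0 < q) {d : ℕ} (hd : 0 < d) (F : Finset ℤ) :
    ∑ m ∈ F, Real.exp (-((1 + Real.log d) * |(m : ℝ)| ^ q)) ≤
      1 + (∑' m : ℤ, Real.exp (-|(m : ℝ)| ^ q)) / d := by
  have hd' : (1 : ℝ) ≤ d := by exact_mod_cast hd
  have hpt : ∀ m : ℤ, Real.exp (-((1 + Real.log d) * |(m : ℝ)| ^ q)) ≤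
      (if m = 0 then 1 else 0) + Real.exp (-|(m : ℝ)| ^ q) / d := fun m => by
    split_ifs with hm
    · rw [hm, Int.cast_zero, abs_zero, Real.zero_rpow hq.ne', mul_zero, neg_zero, Real.exp_zero]
      exact le_add_of_nonneg_right (by positivity)
    · rw [zero_add, le_div_iff₀ (by positivity)]
      nth_rewrite 2 [← Real.exp_log (show (0 : ℝ) < d by positivity)]
      rw [← Real.exp_add]
      apply Real.exp_le_exp.2
      nlinarith [Real.log_nonneg hd', Real.one_le_rpow (one_le_abs_intCast hm) hq.le]
  refine (Finset.sum_le_sum fun m _ => hpt m).trans ?_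
  rw [Finset.sum_add_distrib, Finset.sum_ite_eq', ← Finset.sum_div]
  refine add_le_add (by split_ifs <;> norm_num) ?_
  gcongr
  exact (summable_exp_neg_abs_rpow hq).sum_le_tsum _ fun m _ => (Real.exp_pos _).le

theorem card_le_of_sum_abs_rpow_le {q : ℝ} (hq : 0 < q) {d : ℕ} (hd : 0 < d) {L : ℝ}
    (S : Finset (Fin d → ℤ)) (hS : ∀ k ∈ S, ∑ j, |(k j : ℝ)| ^ q ≤ L) :
    (S.card : ℝ) ≤ Real.exp (∑' m : ℤ, Real.exp (-|(m : ℝ)| ^ q)) *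
      Real.exp (L * (1 + Real.log d)) := by
  classical
  have hd' : (1 : ℝ) ≤ d := by exact_mod_cast hd
  set K := ∑' m : ℤ, Real.exp (-|(m : ℝ)| ^ q)
  have hK : 0 ≤ K := tsum_nonneg fun m => (Real.exp_pos _).le
  set s := 1 + Real.log d
  have hs : 0 ≤ s := by linarith [Real.log_nonneg hd']
  let F : Finset ℤ := Finset.univ.biUnion fun j => S.image fun k => k j
  have hSF : S ⊆ Fintype.piFinset fun _ => F := fun k hk => Fintype.mem_piFinset.2 fun j =>
    Finset.mem_biUnion.2 ⟨j, Finset.mem_univ _, Finset.mem_image_of_mem _ hk⟩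
  calc (S.card : ℝ) = ∑ k ∈ S, 1 := by simp
    _ ≤ ∑ k ∈ S, Real.exp (L * s) * ∏ j, Real.exp (-(s * |(k j : ℝ)| ^ q)) := by
        refine Finset.sum_le_sum fun k hk => ?_
        rw [← Real.exp_sum, ← Real.exp_add]
        apply Real.one_le_exp
        rw [Finset.sum_neg_distrib, ← Finset.mul_sum]
        nlinarith [hS k hk]
    _ ≤ ∑ k ∈ Fintype.piFinset fun _ => F,
          Real.exp (L * s) * ∏ j, Real.exp (-(s * |(k j : ℝ)| ^ q)) :=
        Finset.sum_le_sum_of_subset_of_nonneg hSF fun k _ _ => by positivity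
    _ = Real.exp (L * s) * (∑ m ∈ F, Real.exp (-(s * |(m : ℝ)| ^ q))) ^ d := by
        rw [← Finset.mul_sum, ← Finset.prod_univ_sum (fun _ => F)
          fun _ (m : ℤ) => Real.exp (-(s * |(m : ℝ)| ^ q))]
        simp
    _ ≤ Real.exp (L * s) * Real.exp (K / d) ^ d := by
        gcongr
        refine (sum_exp_neg_mul_abs_rpow_le hq hd F).trans ?_
        rw [add_comm]
        exact Real.add_one_le_exp _
    _ = Real.exp K * Real.exp (L * s) := by
        rw [← Real.exp_nat_mul, mul_div_cancel₀ _ (by positivity), mul_comm]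

theorem quasiPolyTractableGevrey_of_le {α β : ℝ} (hα : 0 < α) (hβ : 0 < β) {p : ℝ≥0∞}
    (hp : 0 < p) (h : p ≤ ENNReal.ofReal α) : quasiPolyTractableGevrey α β p := by
  have hp' : p ≠ ∞ := ne_top_of_le_ne_top ENNReal.ofReal_ne_top h
  have hq : 0 < p.toReal := ENNReal.toReal_pos hp.ne' hp'
  have hqα : p.toReal ≤ α := ENNReal.toReal_le_of_le_ofReal hα.le h
  refine ⟨Real.exp (∑' m : ℤ, Real.exp (-|(m : ℝ)| ^ p.toReal)) + 1, 1 / β, by positivity,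
    by positivity, fun ε d hε hε1 hd => ?_⟩
  have hlogd : 0 ≤ Real.log d := Real.log_natCast_nonneg d
  have hlogε : 0 ≤ Real.log (1 / ε) := Real.log_nonneg (one_le_one_div hε hε1.le)
  have hfin := finite_setOf_mul_wGevrey_lt_one d hα hβ hε hp
  have hle : (infoComplexity d (wGevrey d α β p) (constOne d) ε : ℝ) ≤ hfin.toFinset.card + 1 := by
    exact_mod_cast infoComplexity_le hε.le fun k hk => not_lt.1 fun hlt =>
      hk (hfin.mem_toFinset.2 hlt)
  have hcard := card_le_of_sum_abs_rpow_le hq hd hfin.toFinset fun k hk =>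
    (sum_abs_rpow_le_pNorm_rpow hp hp' hqα k).trans
      ((mul_wGevrey_lt_one_iff hβ hε p k).1 (hfin.mem_toFinset.1 hk)).le
  have hexp : Real.exp (Real.log (1 / ε) / β * (1 + Real.log d)) ≤
      Real.exp (1 / β * (1 + Real.log (1 / ε)) * (1 + Real.log d)) := by
    rw [one_div_mul_eq_div]
    gcongr
    linarith
  have hone : 1 ≤ Real.exp (1 / β * (1 + Real.log (1 / ε)) * (1 + Real.log d)) :=
    Real.one_le_exp (by positivity)
  rw [add_mul, one_mul]
  exact hle.trans (add_le_add (hcard.trans (by gcongr)) hone)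

/-- The vertices of the unit cube have `‖k‖_p^α ≤ d^γ` with `γ < 1` when `α < p`. -/
theorem exists_pNorm_rpow_le {α : ℝ} (hα : 0 < α) {p : ℝ≥0∞} (h : ENNReal.ofReal α < p) :
    ∃ γ : ℝ, 0 ≤ γ ∧ γ < 1 ∧ ∀ d : ℕ, 0 < d → ∀ x : Fin d → ℝ, (∀ j, |x j| ≤ 1) →
      pNorm d p x ^ α ≤ (d : ℝ) ^ γ := by
  by_cases hp' : p = ∞
  · refine ⟨0, le_rfl, one_pos, fun d hd x hx => ?_⟩
    have : Nonempty (Fin d) := ⟨⟨0, hd⟩⟩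
    rw [Real.rpow_zero]
    refine Real.rpow_le_one (pNorm_nonneg _ _ _) ?_ hα.le
    rw [pNorm, if_pos hp']
    exact ciSup_le hx
  · have hαq : α < p.toReal := (ENNReal.ofReal_lt_iff_lt_toReal hα.le hp').1 h
    have hq : 0 < p.toReal := hα.trans hαq
    refine ⟨α / p.toReal, by positivity, (div_lt_one hq).2 hαq, fun d hd x hx => ?_⟩
    rw [pNorm, if_neg hp', ← Real.rpow_mul (by positivity), one_div_mul_eq_div]
    refine Real.rpow_le_rpow (by positivity) ?_ (by positivity)
    calc ∑ j, |x j| ^ p.toReal ≤ ∑ _j : Fin d, 1 :=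
          Finset.sum_le_sum fun j _ => Real.rpow_le_one (abs_nonneg _) (hx j) hq.le
      _ = d := by simp

theorem isLittleO_mul_rpow_mul_log {γ : ℝ} (hγ : 0 ≤ γ) (hγ1 : γ < 1) (a b c t : ℝ) :
    (fun x : ℝ => c + t * (a + b * x ^ γ) * (1 + Real.log x)) =o[atTop] fun x => x := by
  have hconst : ∀ (u : ℝ) {r : ℝ}, 0 < r → (fun _ : ℝ => u) =o[atTop] fun x : ℝ => x ^ r :=
    fun u r hr => Asymptotics.isLittleO_const_left.2
      (Or.inr (tendsto_norm_atTop_atTop.comp (tendsto_rpow_atTop hr)))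
  have hconstO : (fun _ : ℝ => a) =O[atTop] fun x : ℝ => x ^ γ := by
    rcases hγ.eq_or_lt with rfl | hpos
    · simpa using Asymptotics.isBigO_const_const a (one_ne_zero (α := ℝ)) (atTop : Filter ℝ)
    · exact (hconst a hpos).isBigO
  have h1 : (fun x : ℝ => t * (a + b * x ^ γ)) =O[atTop] fun x : ℝ => x ^ γ :=
    (hconstO.add ((Asymptotics.isBigO_refl _ _).const_mul_left b)).const_mul_left t
  have h2 : (fun x : ℝ => 1 + Real.log x) =o[atTop] fun x : ℝ => x ^ (1 - γ) :=
    (hconst 1 (sub_pos.2 hγ1)).add (isLittleO_log_rpow_atTop (sub_pos.2 hγ1))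
  have h3 : (fun x : ℝ => x ^ γ * x ^ (1 - γ)) =ᶠ[atTop] fun x => x := by
    filter_upwards [eventually_gt_atTop 0] with x hx
    rw [← Real.rpow_add hx, add_sub_cancel, Real.rpow_one]
  exact (by simpa using hconst c one_pos : (fun _ : ℝ => c) =o[atTop] fun x : ℝ => x).add
    ((h1.mul_isLittleO h2).trans_eventuallyEq h3)

theorem not_quasiPolyTractableGevrey_of_lt {α β : ℝ} (hα : 0 < α) (hβ : 0 < β) {p : ℝ≥0∞}
    (h : ENNReal.ofReal α < p) : ¬ quasiPolyTractableGevrey α β p := by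
  rintro ⟨C, t, hC, ht, H⟩
  obtain ⟨γ, hγ, hγ1, hnorm⟩ := exists_pNorm_rpow_le hα h
  have hlog2 : 0 < Real.log 2 := Real.log_pos one_lt_two
  have hev := ((isLittleO_mul_rpow_mul_log hγ hγ1 2 β (Real.log C) t).comp_tendsto
    tendsto_natCast_atTop_atTop).def (half_pos hlog2)
  obtain ⟨d, hd, hd0⟩ := (hev.and (eventually_gt_atTop (0 : ℕ))).exists
  have hdpos : (0 : ℝ) < d := by exact_mod_cast hd0
  set ε := Real.exp (-(1 + β * (d : ℝ) ^ γ)) with hεdef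
  have hε : 0 < ε := Real.exp_pos _
  have hε1 : ε < 1 := Real.exp_lt_one_iff.2 (by rw [neg_lt_zero]; positivity)
  have hfin := finite_setOf_mul_wGevrey_lt_one d hα hβ hε (lt_of_le_of_lt zero_le h)
  have hcard := card_lt_infoComplexity (one_le_wGevrey hβ p)
    (S := Fintype.piFinset fun _ : Fin d => ({0, 1} : Finset ℤ)) (T := hfin.toFinset) hε
    (fun k hk => not_lt.1 fun hlt => hk (hfin.mem_toFinset.2 hlt))
    (W := Real.exp (β * (d : ℝ) ^ γ))
    (by rw [hεdef, ← Real.exp_add]; exact Real.exp_lt_one_iff.2 (by linarith)) (Real.exp_pos _)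
    (fun k hk => by
      refine Real.exp_le_exp.2 (mul_le_mul_of_nonneg_left (hnorm d hd0 _ fun j => ?_) hβ.le)
      have hj := Fintype.mem_piFinset.1 hk j
      rw [Finset.mem_insert, Finset.mem_singleton] at hj
      rcases hj with hj | hj <;> simp [hj])
  rw [Fintype.card_piFinset_const, Finset.card_pair zero_ne_one] at hcard
  have hlt : (2 : ℝ) ^ d < C * Real.exp (t * (1 + Real.log (1 / ε)) * (1 + Real.log d)) :=
    lt_of_lt_of_le (by exact_mod_cast hcard) (H ε d hε hε1 hd0)
  have hlogε : Real.log (1 / ε) = 1 + β * (d : ℝ) ^ γ := by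
    rw [one_div, Real.log_inv, hεdef, Real.log_exp, neg_neg]
  have hlt' := Real.log_lt_log (by positivity) hlt
  rw [Real.log_pow, Real.log_mul hC.ne' (Real.exp_pos _).ne', Real.log_exp, hlogε] at hlt'
  have hd' := (le_abs_self _).trans hd
  simp only [Function.comp_apply, Real.norm_eq_abs, abs_of_pos hdpos] at hd'
  rw [show (1 : ℝ) + (1 + β * (d : ℝ) ^ γ) = 2 + β * (d : ℝ) ^ γ by ring] at hlt'
  nlinarith [mul_pos hlog2 hdpos]

/-- `Id : G^{α,β,p}(T^d) → L2(T^d)` is quasi-polynomially tractable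
iff `α ≥ p`. -/
theorem statement19 (α β : ℝ) (hα : 0 < α) (hβ : 0 < β) (p : ℝ≥0∞) (hp : 0 < p) :
    quasiPolyTractableGevrey α β p ↔ p ≤ ENNReal.ofReal α := by
  refine ⟨fun h => not_lt.1 fun hlt => not_quasiPolyTractableGevrey_of_lt hα hβ hlt h,
    quasiPolyTractableGevrey_of_le hα hβ hp⟩

end
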